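/- arXiv:2309.06904 — 5 statements merged into one kernel-verified Lean document; each statement's English description precedes it below -/
import Mathlib

section
/- Let D=(V1,V2;A) be a 2-arc-strong split digraph and let u be a vertex of D such that the subdigraph of D induced by V2∪{u} is semicomplete. Then D has a good (u,u)-pair. In particular, every 2-arc-strong semicomplete split digraph has a good (u,u)-pair for every choice of the vertex u. -/
/-- A digraph on vertex set `V` given by its arc set `A` is strong if every vertex
can reach every other vertex by a directed path. -/
def DigraphStrong {V : Type*} (A : Finset (V × V)) : Prop :=
  ∀ x y : V, Relation.ReflTransGen (fun a b => (a, b) ∈ A) x y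

/-- A digraph is `k`-arc-strong if it remains strong after deleting any set of
at most `k - 1` arcs. -/
def ArcStrong {V : Type*} [DecidableEq V] (k : ℕ) (A : Finset (V × V)) : Prop :=
  ∀ B ⊆ A, B.card < k → DigraphStrong (A \ B)

/-- A strong arc decomposition: a partition of the arc set into two disjoint sets,
each of which forms a strong spanning subdigraph. -/
def StrongArcDecomp {V : Type*} [DecidableEq V] (A : Finset (V × V)) : Prop :=
  ∃ A₁ A₂ : Finset (V × V), A₁ ∪ A₂ = A ∧ Disjoint A₁ A₂ ∧
    DigraphStrong A₁ ∧ DigraphStrong A₂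

/-- `(V₁, V₂; A)` is a split digraph: `V₁, V₂` are nonempty, partition the vertex set,
there are no loops, `V₁` is an independent set, and the subdigraph induced by `V₂`
is semicomplete. -/
def IsSplitDigraph {V : Type*} [Fintype V] [DecidableEq V]
    (V₁ V₂ : Finset V) (A : Finset (V × V)) : Prop :=
  V₁.Nonempty ∧ V₂.Nonempty ∧ Disjoint V₁ V₂ ∧ V₁ ∪ V₂ = Finset.univ ∧
  (∀ v : V, (v, v) ∉ A) ∧
  (∀ u ∈ V₁, ∀ v ∈ V₁, (u, v) ∉ A) ∧
  (∀ u ∈ V₂, ∀ v ∈ V₂, u ≠ v → (u, v) ∈ A ∨ (v, u) ∈ A)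

/-- The out-degree of a vertex. -/
def outDeg {V : Type*} [DecidableEq V] (A : Finset (V × V)) (t : V) : ℕ :=
  (A.filter fun e => e.1 = t).card

/-- The in-degree of a vertex. -/
def inDeg {V : Type*} [DecidableEq V] (A : Finset (V × V)) (t : V) : ℕ :=
  (A.filter fun e => e.2 = t).card

/-- `B ⊆ A` is an out-branching of the digraph `A` rooted at `u`: a spanning oriented
tree in which every vertex other than `u` has in-degree exactly one (so `u` has
in-degree zero and every vertex is reachable from `u`). -/
def IsOutBranching {V : Type*} [DecidableEq V] (A : Finset (V × V)) (u : V)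
    (B : Finset (V × V)) : Prop :=
  B ⊆ A ∧ (∀ v : V, Relation.ReflTransGen (fun a b => (a, b) ∈ B) u v) ∧
  (∀ v : V, v ≠ u → (B.filter fun e => e.2 = v).card = 1) ∧
  (B.filter fun e => e.2 = u) = ∅

/-- `B ⊆ A` is an in-branching of the digraph `A` rooted at `u`: a spanning oriented
tree in which every vertex other than `u` has out-degree exactly one (so `u` has
out-degree zero and every vertex can reach `u`). -/
def IsInBranching {V : Type*} [DecidableEq V] (A : Finset (V × V)) (u : V)
    (B : Finset (V × V)) : Prop :=
  B ⊆ A ∧ (∀ v : V, Relation.ReflTransGen (fun a b => (a, b) ∈ B) v u) ∧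
  (∀ v : V, v ≠ u → (B.filter fun e => e.1 = v).card = 1) ∧
  (B.filter fun e => e.1 = u) = ∅

/-- A good `(u, v)`-pair: an out-branching rooted at `u` and an in-branching rooted
at `v` having no arc in common. -/
def GoodPair {V : Type*} [DecidableEq V] (A : Finset (V × V)) (u v : V) : Prop :=
  ∃ B₁ B₂ : Finset (V × V), IsOutBranching A u B₁ ∧ IsInBranching A v B₂ ∧
    Disjoint B₁ B₂

open Relation in
/-- A walk from `a` to `t` either avoids `x` or passes through it a last time. -/
theorem reflTransGen_avoid {V : Type*} {r : V → V → Prop} {x t : V} (hxt : x ≠ t) {a : V}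
    (h : ReflTransGen r a t) :
    (a ≠ x ∧ ReflTransGen (fun b d => r b d ∧ b ≠ x ∧ d ≠ x) a t) ∨
      ∃ y, y ≠ x ∧ r x y ∧ ReflTransGen (fun b d => r b d ∧ b ≠ x ∧ d ≠ x) y t := by
  induction h using ReflTransGen.head_induction_on with
  | refl => exact Or.inl ⟨hxt.symm, .refl⟩
  | @head b d hbd _ ih =>
    rcases ih with ⟨hd, ih⟩ | ih
    · by_cases hb : b = x
      · exact Or.inr ⟨d, hd, hb ▸ hbd, ih⟩
      · exact Or.inl ⟨hb, ih.head ⟨hbd, hb, hd⟩⟩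
    · exact Or.inr ih

open Relation in
/-- A walk ending in `S` can be cut at its first vertex in `S`. -/
theorem reflTransGen_first {V : Type*} {r : V → V → Prop} {S : V → Prop} {a t : V}
    (h : ReflTransGen r a t) (ht : S t) :
    ∃ s, S s ∧ ReflTransGen (fun b d => r b d ∧ ¬ S b) a s := by
  induction h using ReflTransGen.head_induction_on with
  | refl => exact ⟨t, ht, .refl⟩
  | @head b d hbd _ ih =>
    by_cases hb : S b
    · exact ⟨b, hb, .refl⟩
    · obtain ⟨s, hs, h⟩ := ih
      exact ⟨s, hs, h.head ⟨hbd, hb⟩⟩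

open Relation in
/-- A walk starting in `S` can be cut at its last vertex in `S`. -/
theorem reflTransGen_last {V : Type*} {r : V → V → Prop} {S : V → Prop} {a t : V}
    (h : ReflTransGen r a t) (ha : S a) :
    ∃ s, S s ∧ ReflTransGen (fun b d => r b d ∧ ¬ S d) s t := by
  induction h with
  | refl => exact ⟨a, ha, .refl⟩
  | @tail b d _ hbd ih =>
    by_cases hd : S d
    · exact ⟨d, hd, .refl⟩
    · obtain ⟨s, hs, h⟩ := ih
      exact ⟨s, hs, h.tail ⟨hbd, hd⟩⟩

/-- The net number of arcs of `E` leaving the vertex set `X`. -/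
def netOut {V : Type*} [DecidableEq V] (E : Finset (V × V)) (X : Finset V) : ℤ :=
  ∑ e ∈ E, ((if e.1 ∈ X then 1 else 0) - (if e.2 ∈ X then 1 else 0))

theorem netOut_union {V : Type*} [DecidableEq V] {E F : Finset (V × V)} (h : Disjoint E F)
    (X : Finset V) : netOut (E ∪ F) X = netOut E X + netOut F X :=
  Finset.sum_union h

theorem netOut_sdiff {V : Type*} [DecidableEq V] {E F : Finset (V × V)} (h : F ⊆ E)
    (X : Finset V) : netOut (E \ F) X = netOut E X - netOut F X := by
  have := netOut_union (Finset.sdiff_disjoint (s := F) (t := E)) X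
  rw [Finset.sdiff_union_of_subset h] at this
  omega

theorem netOut_image_swap {V : Type*} [DecidableEq V] (E : Finset (V × V)) (X : Finset V) :
    netOut (E.image Prod.swap) X = - netOut E X := by
  unfold netOut
  rw [Finset.sum_image (fun a _ b _ h => Prod.swap_injective h), ← Finset.sum_neg_distrib]
  exact Finset.sum_congr rfl fun e _ => by simp

/-- The arc set `P` has at most one arc into and at most one arc out of each vertex. -/
def DegreeLeOne {V : Type*} (P : Finset (V × V)) : Prop :=
  (∀ a b d, (a, d) ∈ P → (b, d) ∈ P → a = b) ∧ (∀ a b d, (d, a) ∈ P → (d, b) ∈ P → a = b)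

open Relation in
/-- If `x` reaches `t` then there is a simple path from `x` to `t`, given by its arc set. -/
theorem exists_path {V : Type*} [DecidableEq V] [Fintype V] (Z : Finset V) :
    ∀ {r : V → V → Prop} {x t : V}, (∀ a b, r a b → a ∈ Z ∧ b ∈ Z) → ReflTransGen r x t →
    ∃ P : Finset (V × V), (∀ e ∈ P, r e.1 e.2) ∧ DegreeLeOne P ∧ (∀ a, (a, x) ∉ P) ∧
      ∀ X, netOut P X = (if x ∈ X then 1 else 0) - (if t ∈ X then 1 else 0) := by
  induction Z using Finset.strongInduction with
  | H Z ih =>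
  intro r x t hZ h
  by_cases hxt : x = t
  · exact ⟨∅, by simp, by simp [DegreeLeOne], by simp, by simp [netOut, hxt]⟩
  obtain ⟨hx, -⟩ | ⟨y, hyx, hxy, hyt⟩ := reflTransGen_avoid hxt h
  · exact absurd rfl hx
  have hxZ : x ∈ Z := (hZ x y hxy).1
  obtain ⟨P, hP, hdeg, hy, hbal⟩ := ih (Z.erase x) (Finset.erase_ssubset hxZ)
    (r := fun b d => r b d ∧ b ≠ x ∧ d ≠ x)
    (fun a b hab => by simp [hab.2.1, hab.2.2, hZ a b hab.1]) hyt
  have hout : ∀ a, (x, a) ∉ P := fun a ha => (hP _ ha).2.1 rfl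
  have hin : ∀ a, (a, x) ∉ P := fun a ha => (hP _ ha).2.2 rfl
  refine ⟨insert (x, y) P, ?_, ⟨?_, ?_⟩, ?_, ?_⟩
  · intro e he
    rcases Finset.mem_insert.1 he with rfl | he
    · exact hxy
    · exact (hP _ he).1
  · intro a b d ha hb
    simp only [Finset.mem_insert, Prod.mk.injEq] at ha hb
    have := hdeg.1 a b d
    grind
  · intro a b d ha hb
    simp only [Finset.mem_insert, Prod.mk.injEq] at ha hb
    have := hdeg.2 a b d
    grind
  · intro a ha
    simp only [Finset.mem_insert, Prod.mk.injEq] at ha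
    grind
  · intro X
    have := hbal X
    unfold netOut at this ⊢
    rw [Finset.sum_insert (hout y), this]
    ring

open Relation in
/-- Positive flow from `x` to `t` makes `t` reachable from `x`. -/
theorem reach_of_netOut {V : Type*} [DecidableEq V] [Fintype V] {E : Finset (V × V)} {x t : V}
    {k : ℤ} (hk : 0 < k)
    (h : ∀ X, netOut E X = k * ((if x ∈ X then 1 else 0) - (if t ∈ X then 1 else 0))) :
    ReflTransGen (fun a b => (a, b) ∈ E) x t := by
  classical
  by_contra hxt
  have hX := h (Finset.univ.filter fun v => ReflTransGen (fun a b => (a, b) ∈ E) x v)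
  simp only [Finset.mem_filter, Finset.mem_univ, true_and, if_neg hxt,
    if_pos (ReflTransGen.refl : ReflTransGen (fun a b => (a, b) ∈ E) x x)] at hX
  have : netOut E (Finset.univ.filter fun v => ReflTransGen (fun a b => (a, b) ∈ E) x v) ≤ 0 := by
    refine Finset.sum_nonpos fun e he => ?_
    simp only [Finset.mem_filter, Finset.mem_univ, true_and]
    have : ReflTransGen (fun a b => (a, b) ∈ E) x e.1 →
        ReflTransGen (fun a b => (a, b) ∈ E) x e.2 :=
      fun hh => hh.tail he
    split_ifs <;> simp_all
  omega

open Relation in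
/-- In a 2-arc-strong digraph there are two arc-disjoint simple paths between any two vertices. -/
theorem ArcStrong.exists_disjoint_paths {V : Type*} [DecidableEq V] [Fintype V]
    {A : Finset (V × V)} (h2 : ArcStrong 2 A) (x t : V) :
    ∃ W₁ W₂ : Finset (V × V), W₁ ⊆ A ∧ W₂ ⊆ A ∧ Disjoint W₁ W₂ ∧
      DegreeLeOne W₁ ∧ DegreeLeOne W₂ ∧
      ReflTransGen (fun a b => (a, b) ∈ W₁) x t ∧ ReflTransGen (fun a b => (a, b) ∈ W₂) x t := by
  classical
  by_cases hxt : x = t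
  · subst hxt
    exact ⟨∅, ∅, by simp, by simp, by simp, by simp [DegreeLeOne], by simp [DegreeLeOne],
      .refl, .refl⟩
  have hA : ReflTransGen (fun a b => (a, b) ∈ A) x t := by
    simpa using h2 ∅ (by simp) (by simp) x t
  obtain ⟨F, hFA, -, -, hF⟩ := exists_path Finset.univ (by simp) hA
  have hFA : F ⊆ A := fun e he => hFA e he
  set r : V → V → Prop := fun a b => (a, b) ∈ A \ F ∨ (b, a) ∈ F with hr
  have hres : ReflTransGen r x t := by
    by_contra hcon
    set X : Finset V := Finset.univ.filter fun v => ReflTransGen r x v with hX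
    have hmem : ∀ v, v ∈ X ↔ ReflTransGen r x v := by simp [hX]
    have hxX : x ∈ X := (hmem x).2 .refl
    have htX : t ∉ X := fun h => hcon ((hmem t).1 h)
    have hbal := hF X
    rw [if_pos hxX, if_neg htX] at hbal
    set B := F.filter fun e => e.1 ∈ X ∧ e.2 ∉ X with hB
    have hcard : (B.card : ℤ) = 1 := by
      rw [hB, Finset.card_filter]
      push_cast
      rw [← sub_zero (1 : ℤ), ← hbal]
      refine Finset.sum_congr rfl fun e he => ?_
      have : e.2 ∈ X → e.1 ∈ X := fun h => (hmem _).2 (((hmem _).1 h).tail (Or.inr he))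
      split_ifs <;> simp_all
    have hstrong := h2 B ((Finset.filter_subset _ _).trans hFA) (by omega) x t
    have hall : ∀ v, ReflTransGen (fun a b => (a, b) ∈ A \ B) x v → v ∈ X := by
      intro v hv
      induction hv with
      | refl => exact hxX
      | @tail a b _ hab ih =>
        rw [Finset.mem_sdiff] at hab
        by_contra hb
        by_cases habF : (a, b) ∈ F
        · exact hab.2 (Finset.mem_filter.2 ⟨habF, ih, hb⟩)
        · exact hb ((hmem _).2 (((hmem _).1 ih).tail
            (Or.inl (Finset.mem_sdiff.2 ⟨hab.1, habF⟩))))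
    exact htX (hall t hstrong)
  obtain ⟨P, hP, -, -, hPbal⟩ := exists_path Finset.univ (by simp) hres
  set Pf := P.filter fun e => e ∈ A \ F with hPf
  set Pb := (P \ Pf).image Prod.swap with hPb
  have hPbF : Pb ⊆ F := by
    intro e he
    obtain ⟨e', he', rfl⟩ := Finset.mem_image.1 he
    rw [Finset.mem_sdiff, hPf, Finset.mem_filter] at he'
    exact (hP _ he'.1).resolve_left fun h => he'.2 ⟨he'.1, h⟩
  have hPfA : Pf ⊆ A \ F := fun e he => (Finset.mem_filter.1 he).2
  set E := F \ Pb ∪ Pf with hE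
  have hEA : E ⊆ A := Finset.union_subset (Finset.sdiff_subset.trans hFA)
    (hPfA.trans Finset.sdiff_subset)
  have hEbal : ∀ X, netOut E X =
      2 * ((if x ∈ X then 1 else 0) - (if t ∈ X then 1 else 0)) := by
    intro X
    rw [hE, netOut_union (Finset.disjoint_of_subset_left Finset.sdiff_subset
      (Finset.disjoint_of_subset_right hPfA Finset.disjoint_sdiff)), netOut_sdiff hPbF, hPb,
      netOut_image_swap, netOut_sdiff (Finset.filter_subset _ _), hF, hPbal]
    ring
  obtain ⟨W₁, hW₁E, hdeg₁, -, hW₁⟩ :=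
    exists_path Finset.univ (by simp) (reach_of_netOut two_pos hEbal)
  have hW₁E : W₁ ⊆ E := fun e he => hW₁E e he
  have hrest : ∀ X, netOut (E \ W₁) X =
      1 * ((if x ∈ X then 1 else 0) - (if t ∈ X then 1 else 0)) := by
    intro X
    rw [netOut_sdiff hW₁E, hEbal, hW₁]
    ring
  obtain ⟨W₂, hW₂E, hdeg₂, -, hW₂⟩ :=
    exists_path Finset.univ (by simp) (reach_of_netOut one_pos hrest)
  have hW₂E : W₂ ⊆ E \ W₁ := fun e he => hW₂E e he
  exact ⟨W₁, W₂, hW₁E.trans hEA, (hW₂E.trans Finset.sdiff_subset).trans hEA,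
    Finset.disjoint_of_subset_right hW₂E Finset.disjoint_sdiff, hdeg₁, hdeg₂,
    reach_of_netOut one_pos (by simpa using hW₁), reach_of_netOut one_pos (by simpa using hW₂)⟩

open Relation in
/-- If every vertex is reachable from `u` there is a spanning tree given by a parent function. -/
theorem exists_parent {V : Type*} {r : V → V → Prop} {u : V} (h : ∀ v, ReflTransGen r u v) :
    ∃ p : V → V, (∀ v, v ≠ u → r (p v) v) ∧
      ∀ s : V → V → Prop, (∀ v, v ≠ u → s (p v) v) → ∀ v, ReflTransGen s u v := by
  classical
  let R : ℕ → V → Prop := fun n =>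
    Nat.rec (motive := fun _ => V → Prop) (· = u) (fun _ S v => ∃ w, S w ∧ r w v) n
  have hR : ∀ v : V, ∃ n, R n v := by
    intro v
    induction h v with
    | refl => exact ⟨0, rfl⟩
    | @tail b d _ hbd ih =>
      obtain ⟨n, hn⟩ := ih
      exact ⟨n + 1, b, hn, hbd⟩
  have hpar : ∀ v : V, ∃ w : V, v ≠ u → r w v ∧ Nat.find (hR w) < Nat.find (hR v) := by
    intro v
    by_cases hv : v = u
    · exact ⟨v, fun h => absurd hv h⟩
    have hspec := Nat.find_spec (hR v)
    rcases hn : Nat.find (hR v) with _ | n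
    · rw [hn] at hspec
      exact absurd hspec hv
    · rw [hn] at hspec
      obtain ⟨w, hw, hwv⟩ := hspec
      exact ⟨w, fun _ => ⟨hwv, Nat.lt_succ_of_le (Nat.find_min' _ hw)⟩⟩
  choose p hp using hpar
  refine ⟨p, fun v hv => (hp v hv).1, fun s hs v => ?_⟩
  induction hn : Nat.find (hR v) using Nat.strong_induction_on generalizing v with
  | _ n ih =>
    by_cases hv : v = u
    · rw [hv]
    · exact (ih _ (hn ▸ (hp v hv).2) _ rfl).tail (hs v hv)

open Relation in
theorem exists_isOutBranching {V : Type*} [Fintype V] [DecidableEq V] {A G : Finset (V × V)}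
    {u : V} (hGA : G ⊆ A) (h : ∀ v, ReflTransGen (fun a b => (a, b) ∈ G) u v) :
    ∃ B ⊆ G, IsOutBranching A u B := by
  obtain ⟨p, hp, hspan⟩ := exists_parent h
  set B := (Finset.univ.erase u).image fun v => (p v, v) with hB
  have hmem : ∀ a v, (a, v) ∈ B ↔ v ≠ u ∧ a = p v := by
    intro a v
    simp only [hB, Finset.mem_image, Finset.mem_erase, Finset.mem_univ, and_true, Prod.mk.injEq]
    grind
  have hBG : B ⊆ G := by
    rintro ⟨a, v⟩ hav
    obtain ⟨hv, rfl⟩ := (hmem a v).1 hav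
    exact hp v hv
  refine ⟨B, hBG, hBG.trans hGA, hspan _ fun v hv => (hmem _ _).2 ⟨hv, rfl⟩, fun v hv => ?_, ?_⟩
  · rw [Finset.card_eq_one]
    refine ⟨(p v, v), ?_⟩
    ext ⟨a, b⟩
    simp only [Finset.mem_filter, hmem, Finset.mem_singleton, Prod.mk.injEq]
    grind
  · ext ⟨a, b⟩
    simp only [Finset.mem_filter, hmem, Finset.notMem_empty]
    grind

open Relation in
theorem exists_isInBranching {V : Type*} [Fintype V] [DecidableEq V] {A G : Finset (V × V)}
    {u : V} (hGA : G ⊆ A) (h : ∀ v, ReflTransGen (fun a b => (a, b) ∈ G) v u) :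
    ∃ B ⊆ G, IsInBranching A u B := by
  obtain ⟨p, hp, hspan⟩ := exists_parent (r := fun a b => (b, a) ∈ G)
    (fun v => reflTransGen_swap.1 (h v))
  set B := (Finset.univ.erase u).image fun v => (v, p v) with hB
  have hmem : ∀ v a, (v, a) ∈ B ↔ v ≠ u ∧ a = p v := by
    intro a v
    simp only [hB, Finset.mem_image, Finset.mem_erase, Finset.mem_univ, and_true, Prod.mk.injEq]
    grind
  have hBG : B ⊆ G := by
    rintro ⟨v, a⟩ hav
    obtain ⟨hv, rfl⟩ := (hmem v a).1 hav
    exact hp v hv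
  refine ⟨B, hBG, hBG.trans hGA, fun v => reflTransGen_swap.1
    (hspan (fun a b => (b, a) ∈ B) (fun v hv => (hmem _ _).2 ⟨hv, rfl⟩) v), fun v hv => ?_, ?_⟩
  · rw [Finset.card_eq_one]
    refine ⟨(v, p v), ?_⟩
    ext ⟨a, b⟩
    simp only [Finset.mem_filter, hmem, Finset.mem_singleton, Prod.mk.injEq]
    grind
  · ext ⟨a, b⟩
    simp only [Finset.mem_filter, hmem, Finset.notMem_empty]
    grind

open Relation in
/-- A finite set on which a relation is semicomplete has a vertex reachable from all others;
the empty set is dealt with by a default vertex. -/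
theorem exists_sink {V : Type*} [DecidableEq V] {r : V → V → Prop} (u : V) (P : Finset V)
    (h : ∀ a ∈ P, ∀ b ∈ P, a ≠ b → r a b ∨ r b a) :
    ∃ c ∈ insert u P, ∀ a ∈ P, ReflTransGen (fun a b => r a b ∧ a ∈ P ∧ b ∈ P) a c := by
  rcases P.eq_empty_or_nonempty with rfl | hne
  · exact ⟨u, by simp, by simp⟩
  suffices ∃ c ∈ P, ∀ a ∈ P, ReflTransGen (fun a b => r a b ∧ a ∈ P ∧ b ∈ P) a c by
    obtain ⟨c, hc, h⟩ := this
    exact ⟨c, Finset.mem_insert_of_mem hc, h⟩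
  induction hne using Finset.Nonempty.cons_induction with
  | singleton a => exact ⟨a, by simp, by simp; rfl⟩
  | cons p P hp _ ih =>
    simp only [Finset.mem_cons] at h ⊢
    obtain ⟨c, hc, hreach⟩ := ih fun a ha b hb => h a (Or.inr ha) b (Or.inr hb)
    have hreach : ∀ a ∈ P, ReflTransGen
        (fun a b => r a b ∧ (a = p ∨ a ∈ P) ∧ (b = p ∨ b ∈ P)) a c := fun a ha =>
      ReflTransGen.mono (fun _ _ h => ⟨h.1, Or.inr h.2.1, Or.inr h.2.2⟩) _ _ (hreach a ha)
    rcases h p (Or.inl rfl) c (Or.inr hc) (fun h => hp (h ▸ hc)) with hpc | hcp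
    · refine ⟨c, Or.inr hc, fun a ha => ?_⟩
      rcases ha with rfl | ha
      · exact .single ⟨hpc, Or.inl rfl, Or.inr hc⟩
      · exact hreach a ha
    · refine ⟨p, Or.inl rfl, fun a ha => ?_⟩
      rcases ha with rfl | ha
      · exact .refl
      · exact (hreach a ha).tail ⟨hcp, Or.inr hc, Or.inl rfl⟩

open Relation in
theorem ArcStrong.exists_in_arc {V : Type*} [DecidableEq V] {A W : Finset (V × V)}
    (h2 : ArcStrong 2 A) (hWA : W ⊆ A) (hW : DegreeLeOne W) {u v : V} (huv : u ≠ v) :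
    ∃ a, (a, v) ∈ A ∧ (a, v) ∉ W := by
  have hcard : (W.filter fun e => e.2 = v).card < 2 := by
    rw [Nat.lt_succ_iff, Finset.card_le_one]
    rintro ⟨a, b⟩ ha ⟨a', b'⟩ ha'
    simp only [Finset.mem_filter] at ha ha'
    obtain ⟨ha, rfl⟩ := ha
    obtain ⟨ha', rfl⟩ := ha'
    rw [hW.1 a a' _ ha ha']
  obtain h | ⟨a, -, ha⟩ :=
    ReflTransGen.cases_tail (h2 _ ((Finset.filter_subset _ _).trans hWA) hcard u v)
  · exact absurd h.symm huv
  · simp only [Finset.mem_sdiff, Finset.mem_filter, and_true] at ha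
    exact ⟨a, ha⟩

open Relation in
theorem ArcStrong.exists_out_arc {V : Type*} [DecidableEq V] {A W : Finset (V × V)}
    (h2 : ArcStrong 2 A) (hWA : W ⊆ A) (hW : DegreeLeOne W) {u v : V} (huv : u ≠ v) :
    ∃ b, (v, b) ∈ A ∧ (v, b) ∉ W := by
  have hcard : (W.filter fun e => e.1 = v).card < 2 := by
    rw [Nat.lt_succ_iff, Finset.card_le_one]
    rintro ⟨b, a⟩ ha ⟨b', a'⟩ ha'
    simp only [Finset.mem_filter] at ha ha'
    obtain ⟨ha, rfl⟩ := ha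
    obtain ⟨ha', rfl⟩ := ha'
    rw [hW.2 a a' _ ha ha']
  obtain h | ⟨a, ha, -⟩ :=
    ReflTransGen.cases_head (h2 _ ((Finset.filter_subset _ _).trans hWA) hcard v u)
  · exact absurd h.symm huv
  · simp only [Finset.mem_sdiff, Finset.mem_filter, and_true] at ha
    exact ⟨a, ha⟩

/-- Corollary 4.6: let `D = (V₁, V₂; A)` be a 2-arc-strong split digraph and `u` a
vertex such that the subdigraph induced by `V₂ ∪ {u}` is semicomplete.  Then `D` has
a good `(u, u)`-pair.  (In particular, every 2-arc-strong semicomplete split digraph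
has a good `(u, u)`-pair for every choice of `u`.) -/
theorem stmt15 {V : Type*} [Fintype V] [DecidableEq V]
    (V₁ V₂ : Finset V) (A : Finset (V × V))
    (hsplit : IsSplitDigraph V₁ V₂ A)
    (h2 : ArcStrong 2 A)
    (u : V)
    (hsemi : ∀ a ∈ insert u V₂, ∀ b ∈ insert u V₂, a ≠ b → (a, b) ∈ A ∨ (b, a) ∈ A) :
    GoodPair A u u := by
  obtain ⟨-, -, -, hcover, -, hindep, -⟩ := hsplit
  have hcross : ∀ a b, (a, b) ∈ A → a ∈ V₂ ∨ b ∈ V₂ := by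
    intro a b hab
    have ha : a ∈ V₁ ∪ V₂ := hcover ▸ Finset.mem_univ a
    have hb : b ∈ V₁ ∪ V₂ := hcover ▸ Finset.mem_univ b
    rw [Finset.mem_union] at ha hb
    by_contra! h
    exact hindep a (ha.resolve_right h.1) b (hb.resolve_right h.2) hab
  set S := insert u V₂ with hS
  set P := (S.erase u).filter fun v => (u, v) ∈ A with hP
  set Q := (S.erase u).filter fun v => (u, v) ∉ A with hQ
  have hPS : ∀ v ∈ P, v ∈ S := by simp +contextual [hP]
  have hQS : ∀ v ∈ Q, v ∈ S := by simp +contextual [hQ]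
  have huP : u ∉ P := by simp [hP]
  have huQ : u ∉ Q := by simp [hQ]
  have huS : u ∈ S := Finset.mem_insert_self _ _
  have hPQ : ∀ v ∈ P, v ∉ Q := by simp +contextual [hP, hQ]
  have hSPQ : ∀ v ∈ S, v = u ∨ v ∈ P ∨ v ∈ Q := by
    intro v hv
    simp only [hP, hQ, Finset.mem_filter, Finset.mem_erase]
    tauto
  have hPA : ∀ v ∈ P, (u, v) ∈ A := fun v hv => (Finset.mem_filter.1 hv).2
  have hQA : ∀ v ∈ Q, (v, u) ∈ A := by
    intro v hv
    have h := Finset.mem_filter.1 hv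
    exact (hsemi u huS v (hQS v hv) (Finset.ne_of_mem_erase h.1).symm).resolve_left h.2
  obtain ⟨c, hc, hcP⟩ := exists_sink (r := fun a b => (a, b) ∈ A) u P
    fun a ha b hb => hsemi a (hPS a ha) b (hPS b hb)
  obtain ⟨d, hd, hdQ⟩ := exists_sink (r := fun a b => (b, a) ∈ A) u Q
    fun a ha b hb hab => (hsemi a (hQS a ha) b (hQS b hb) hab).symm
  obtain ⟨W₁, W₂, hW₁A, hW₂A, hW, hdeg₁, hdeg₂, hreach₁, hreach₂⟩ :=
    h2.exists_disjoint_paths c d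
  rw [Finset.disjoint_left] at hW
  set G₁ := A.filter fun e => (e.1 = u ∧ e.2 ∈ P) ∨ (e.1 ∈ Q ∧ e.2 ∈ Q) ∨
    (e ∈ W₂ ∧ e.2 ∉ insert u P) ∨ (e.2 ∉ S ∧ e ∉ W₁) with hG₁
  set G₂ := A.filter fun e => (e.1 ∈ Q ∧ e.2 = u) ∨ (e.1 ∈ P ∧ e.2 ∈ P) ∨
    (e ∈ W₁ ∧ e.1 ∉ insert u Q) ∨ (e.1 ∉ S ∧ e ∉ W₂) with hG₂
  have hdisj : Disjoint G₁ G₂ := by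
    rw [Finset.disjoint_left]
    rintro ⟨a, b⟩ h₁ h₂
    simp only [hG₁, hG₂, Finset.mem_filter, Finset.mem_insert] at h₁ h₂
    have hab : a ∈ S ∨ b ∈ S :=
      (hcross a b h₁.1).imp (Finset.mem_insert_of_mem ·) (Finset.mem_insert_of_mem ·)
    have := hW (a := (a, b))
    have h1 := hPS a; have h2 := hPS b; have h3 := hQS a; have h4 := hQS b
    have h5 := hPQ a; have h6 := hPQ b
    rcases h₁ with ⟨-, h₁ | h₁ | h₁ | h₁⟩ <;> rcases h₂ with ⟨-, h₂ | h₂ | h₂ | h₂⟩ <;> grind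
  have hout : ∀ v, Relation.ReflTransGen (fun a b => (a, b) ∈ G₁) u v := by
    have huP : ∀ s ∈ insert u P, Relation.ReflTransGen (fun a b => (a, b) ∈ G₁) u s := by
      intro s hs
      rcases Finset.mem_insert.1 hs with rfl | hs
      · exact .refl
      · exact .single (Finset.mem_filter.2 ⟨hPA s hs, Or.inl ⟨rfl, hs⟩⟩)
    have hd : Relation.ReflTransGen (fun a b => (a, b) ∈ G₁) u d := by
      obtain ⟨s, hs, h⟩ := reflTransGen_last (S := fun v => v ∈ insert u P) hreach₂ hc
      exact (huP s hs).trans (Relation.ReflTransGen.mono (fun a b h => Finset.mem_filter.2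
        ⟨hW₂A h.1, Or.inr (Or.inr (Or.inl h))⟩) _ _ h)
    have hS : ∀ v ∈ S, Relation.ReflTransGen (fun a b => (a, b) ∈ G₁) u v := by
      intro v hv
      rcases hSPQ v hv with rfl | hv | hv
      · exact .refl
      · exact huP v (Finset.mem_insert_of_mem hv)
      · refine hd.trans (Relation.ReflTransGen.mono ?_ _ _
          (Relation.reflTransGen_swap.1 (hdQ v hv)))
        exact fun a b h => Finset.mem_filter.2 ⟨h.1, Or.inr (Or.inl ⟨h.2.2, h.2.1⟩)⟩
    intro v
    by_cases hv : v ∈ S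
    · exact hS v hv
    obtain ⟨a, haA, haW⟩ := h2.exists_in_arc hW₁A hdeg₁ (fun h : u = v => hv (h ▸ huS))
    have ha : a ∈ S := Finset.mem_insert_of_mem
      ((hcross a v haA).resolve_right fun h => hv (Finset.mem_insert_of_mem h))
    exact (hS a ha).tail (Finset.mem_filter.2 ⟨haA, Or.inr (Or.inr (Or.inr ⟨hv, haW⟩))⟩)
  have hin : ∀ v, Relation.ReflTransGen (fun a b => (a, b) ∈ G₂) v u := by
    have huQ : ∀ s ∈ insert u Q, Relation.ReflTransGen (fun a b => (a, b) ∈ G₂) s u := by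
      intro s hs
      rcases Finset.mem_insert.1 hs with rfl | hs
      · exact .refl
      · exact .single (Finset.mem_filter.2 ⟨hQA s hs, Or.inl ⟨hs, rfl⟩⟩)
    have hc : Relation.ReflTransGen (fun a b => (a, b) ∈ G₂) c u := by
      obtain ⟨s, hs, h⟩ := reflTransGen_first (S := fun v => v ∈ insert u Q) hreach₁ hd
      exact (Relation.ReflTransGen.mono (fun a b h => Finset.mem_filter.2
        ⟨hW₁A h.1, Or.inr (Or.inr (Or.inl h))⟩) _ _ h).trans (huQ s hs)
    have hS : ∀ v ∈ S, Relation.ReflTransGen (fun a b => (a, b) ∈ G₂) v u := by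
      intro v hv
      rcases hSPQ v hv with rfl | hv | hv
      · exact .refl
      · refine Relation.ReflTransGen.trans (Relation.ReflTransGen.mono ?_ _ _ (hcP v hv)) hc
        exact fun a b h => Finset.mem_filter.2 ⟨h.1, Or.inr (Or.inl h.2)⟩
      · exact huQ v (Finset.mem_insert_of_mem hv)
    intro v
    by_cases hv : v ∈ S
    · exact hS v hv
    obtain ⟨b, hbA, hbW⟩ := h2.exists_out_arc hW₂A hdeg₂ (fun h : u = v => hv (h ▸ huS))
    have hb : b ∈ S := Finset.mem_insert_of_mem
      ((hcross v b hbA).resolve_left fun h => hv (Finset.mem_insert_of_mem h))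
    exact (hS b hb).head (Finset.mem_filter.2 ⟨hbA, Or.inr (Or.inr (Or.inr ⟨hv, hbW⟩))⟩)
  obtain ⟨B₁, hB₁, hB₁out⟩ := exists_isOutBranching (Finset.filter_subset _ _) hout
  obtain ⟨B₂, hB₂, hB₂in⟩ := exists_isInBranching (Finset.filter_subset _ _) hin
  exact ⟨B₁, B₂, hB₁out, hB₂in, Finset.disjoint_of_subset_left hB₁
    (Finset.disjoint_of_subset_right hB₂ hdisj)⟩
end

section
/- For every semicomplete digraph W and every vertex u_t⁺ of W, the split digraph D1 = D1(W, u_t⁺) is 2-strong and has no good (u,v)-pair, where D1 is defined as follows: its vertex set is V1 ∪ V2 with V1 = {u_t, w, v_t} and V2 = {b, v, u, a} ∪ V(W) (where b, v, u, a, u_t, w, v_t are new vertices not in V(W)); its arcs are: all arcs of W; the arc b→v; arcs from b and from v to every vertex of V(W); arcs from every vertex of V(W) to u and to a; the arcs b→u, b→a, v→u, v→a and u→a; the 2-cycles u↔u_t, a↔w, b↔w and v↔v_t; and the arcs a→u_t, u_t→u_t⁺, u_t⁺→v_t and v_t→b. -/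
/-- In the digraph with arc set `A`, every ordered pair of vertices of `X` is joined
by a directed path all of whose vertices lie in `X`. -/
def StrongOn {V : Type*} (X : Finset V) (A : Finset (V × V)) : Prop :=
  ∀ x ∈ X, ∀ y ∈ X, Relation.ReflTransGen (fun a b => a ∈ X ∧ b ∈ X ∧ (a, b) ∈ A) x y

/-- A digraph is `k`-strong: it has at least `k + 1` vertices and deleting any set of
fewer than `k` vertices leaves a strong digraph. -/
def KStrong {V : Type*} [Fintype V] [DecidableEq V] (k : ℕ) (A : Finset (V × V)) : Prop :=
  k + 1 ≤ Fintype.card V ∧ ∀ X : Finset V, X.card < k → StrongOn Xᶜ A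

/-- The arc set of the split digraph `D₁ = D₁(W, u_t⁺)`.  The vertices are
`Sum.inl 0 = b`, `Sum.inl 1 = v`, `Sum.inl 2 = u`, `Sum.inl 3 = a`,
`Sum.inl 4 = u_t`, `Sum.inl 5 = w`, `Sum.inl 6 = v_t`, and `Sum.inr x` for the
vertices `x` of `W`; the distinguished vertex `u_t⁺` of `W` is `w0`. -/
def D1Arcs {VW : Type*} [Fintype VW] [DecidableEq VW]
    (AW : Finset (VW × VW)) (w0 : VW) : Finset ((Fin 7 ⊕ VW) × (Fin 7 ⊕ VW)) :=
  (AW.image fun e => (Sum.inr e.1, Sum.inr e.2)) ∪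
  (Finset.univ.image fun x : VW => ((Sum.inl 0 : Fin 7 ⊕ VW), Sum.inr x)) ∪
  (Finset.univ.image fun x : VW => ((Sum.inl 1 : Fin 7 ⊕ VW), Sum.inr x)) ∪
  (Finset.univ.image fun x : VW => ((Sum.inr x : Fin 7 ⊕ VW), Sum.inl 2)) ∪
  (Finset.univ.image fun x : VW => ((Sum.inr x : Fin 7 ⊕ VW), Sum.inl 3)) ∪
  ({(Sum.inl 0, Sum.inl 1), (Sum.inl 0, Sum.inl 2), (Sum.inl 0, Sum.inl 3),
    (Sum.inl 1, Sum.inl 2), (Sum.inl 1, Sum.inl 3), (Sum.inl 2, Sum.inl 3),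
    (Sum.inl 2, Sum.inl 4), (Sum.inl 4, Sum.inl 2),
    (Sum.inl 3, Sum.inl 5), (Sum.inl 5, Sum.inl 3),
    (Sum.inl 0, Sum.inl 5), (Sum.inl 5, Sum.inl 0),
    (Sum.inl 1, Sum.inl 6), (Sum.inl 6, Sum.inl 1),
    (Sum.inl 3, Sum.inl 4), (Sum.inl 4, Sum.inr w0), (Sum.inr w0, Sum.inl 6),
    (Sum.inl 6, Sum.inl 0)} : Finset ((Fin 7 ⊕ VW) × (Fin 7 ⊕ VW)))

/-- The spanning out-branching enters every nonempty set avoiding its root. -/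
lemma IsOutBranching.exists_entering {V : Type*} [DecidableEq V] {A B : Finset (V × V)} {u : V}
    (h : IsOutBranching A u B) (S : V → Prop) (hu : ¬ S u) {y : V} (hy : S y) :
    ∃ p q, ¬ S p ∧ S q ∧ (p, q) ∈ B ∧ (p, q) ∈ A := by
  by_contra! hcon
  suffices ∀ z, Relation.ReflTransGen (fun a b => (a, b) ∈ B) u z → ¬ S z from
    this y (h.2.1 y) hy
  intro z hz
  induction hz with
  | refl => exact hu
  | tail _ hbc ih => exact fun hc => hcon _ _ ih hc hbc (h.1 hbc)

/-- The spanning in-branching leaves every nonempty set avoiding its root. -/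
lemma IsInBranching.exists_leaving {V : Type*} [DecidableEq V] {A B : Finset (V × V)} {u : V}
    (h : IsInBranching A u B) (S : V → Prop) (hu : ¬ S u) {y : V} (hy : S y) :
    ∃ p q, S p ∧ ¬ S q ∧ (p, q) ∈ B ∧ (p, q) ∈ A := by
  by_contra! hcon
  suffices ∀ z, Relation.ReflTransGen (fun a b => (a, b) ∈ B) y z → S z from
    hu (this u (h.2.1 y))
  intro z hz
  induction hz with
  | refl => exact hy
  | tail _ hbc ih => exact by_contra fun hc => hcon _ _ ih hc hbc (h.1 hbc)

section D1

variable {VW : Type*} [Fintype VW] [DecidableEq VW] {AW : Finset (VW × VW)} {w0 : VW}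

@[simp]
lemma inl_inl_mem_D1Arcs {i j : Fin 7} :
    ((Sum.inl i, Sum.inl j) : (Fin 7 ⊕ VW) × (Fin 7 ⊕ VW)) ∈ D1Arcs AW w0 ↔
      (i, j) ∈ ({(0, 1), (0, 2), (0, 3), (1, 2), (1, 3), (2, 3), (2, 4), (4, 2), (3, 5), (5, 3),
        (0, 5), (5, 0), (1, 6), (6, 1), (3, 4), (6, 0)} : Finset (Fin 7 × Fin 7)) := by
  simp [D1Arcs]

@[simp]
lemma inl_inr_mem_D1Arcs {i : Fin 7} {x : VW} :
    ((Sum.inl i, Sum.inr x) : (Fin 7 ⊕ VW) × (Fin 7 ⊕ VW)) ∈ D1Arcs AW w0 ↔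
      i = 0 ∨ i = 1 ∨ i = 4 ∧ x = w0 := by
  simp [D1Arcs, eq_comm]
  tauto

@[simp]
lemma inr_inl_mem_D1Arcs {i : Fin 7} {x : VW} :
    ((Sum.inr x, Sum.inl i) : (Fin 7 ⊕ VW) × (Fin 7 ⊕ VW)) ∈ D1Arcs AW w0 ↔
      i = 2 ∨ i = 3 ∨ x = w0 ∧ i = 6 := by
  simp [D1Arcs, eq_comm]
  tauto

@[simp]
lemma inr_inr_mem_D1Arcs {x y : VW} :
    ((Sum.inr x, Sum.inr y) : (Fin 7 ⊕ VW) × (Fin 7 ⊕ VW)) ∈ D1Arcs AW w0 ↔ (x, y) ∈ AW := by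
  simp [D1Arcs]

lemma D1Arcs_isSplitDigraph (hloopW : ∀ x : VW, (x, x) ∉ AW)
    (hsemiW : ∀ x y : VW, x ≠ y → (x, y) ∈ AW ∨ (y, x) ∈ AW) :
    IsSplitDigraph
      ({Sum.inl 4, Sum.inl 5, Sum.inl 6} : Finset (Fin 7 ⊕ VW))
      (({Sum.inl 0, Sum.inl 1, Sum.inl 2, Sum.inl 3} : Finset (Fin 7 ⊕ VW)) ∪
        Finset.univ.image Sum.inr)
      (D1Arcs AW w0) := by
  refine ⟨by simp, by simp, ?_, ?_, ?_, ?_, ?_⟩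
  · simp [Finset.disjoint_left]
  · ext x
    rcases x with i | x
    · fin_cases i <;> simp
    · simp
  · rintro (i | x)
    · fin_cases i <;> simp
    · simpa using hloopW x
  · simp
  · rintro (i | x) hx (j | y) hy hne
    · fin_cases i <;> simp at hx <;> fin_cases j <;> simp at hy hne <;> simp
    · fin_cases i <;> simp at hx <;> simp
    · fin_cases j <;> simp at hy <;> simp
    · simpa using hsemiW x y (by simpa using hne)

lemma D1Arcs_kStrong : KStrong 2 (D1Arcs AW w0) := by
  refine ⟨by simp; omega, fun X hX x hx y hy => ?_⟩
  set P : Fin 7 ⊕ VW → Prop := Relation.ReflTransGen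
    (fun a b => a ∈ Xᶜ ∧ b ∈ Xᶜ ∧ (a, b) ∈ D1Arcs AW w0) x
  have step {p q : Fin 7 ⊕ VW} (hp : p ∈ Xᶜ) (hq : q ∈ Xᶜ) (h : (p, q) ∈ D1Arcs AW w0)
      (hP : P p) : P q := hP.tail ⟨hp, hq, h⟩
  have alive {p q : Fin 7 ⊕ VW} (hpq : p ≠ q) : p ∈ Xᶜ ∨ q ∈ Xᶜ := by
    by_contra! h
    simp only [Finset.mem_compl, not_not] at h
    exact hpq (Finset.card_le_one.1 (by omega) _ h.1 _ h.2)
  have hPx : P x := .refl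
  have reach_inl : ∀ j, Sum.inl j ∈ Xᶜ → P (Sum.inl j) := by
    have arc (i j : Fin 7) (h : (Sum.inl i, Sum.inl j) ∈ D1Arcs AW w0) hi hj :=
      step (p := Sum.inl i) (q := Sum.inl j) hi hj h
    have alive_inl (i j : Fin 7) (h : i ≠ j) :=
      alive (p := Sum.inl i) (q := Sum.inl j) (by simpa using h)
    have alive_w0 (i : Fin 7) := alive (p := Sum.inl i) (q := Sum.inr w0) (by simp)
    have from_w0 (i : Fin 7) (h : (Sum.inr w0, Sum.inl i) ∈ D1Arcs AW w0) hi hj :=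
      step (p := Sum.inr w0) (q := Sum.inl i) hi hj h
    have to_w0 (i : Fin 7) (h : (Sum.inl i, Sum.inr w0) ∈ D1Arcs AW w0) hi hj :=
      step (p := Sum.inl i) (q := Sum.inr w0) hi hj h
    have start : ∃ i, Sum.inl i ∈ Xᶜ ∧ P (Sum.inl i) := by
      rcases x with i | x
      · exact ⟨i, hx, hPx⟩
      · rcases alive_inl 2 3 (by decide) with h | h
        · exact ⟨2, h, step hx h (by simp) hPx⟩
        · exact ⟨3, h, step hx h (by simp) hPx⟩
    simp [Fin.forall_fin_succ, -Finset.mem_compl] at arc alive_inl alive_w0 from_w0 to_w0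
    simp [Fin.exists_fin_succ, Fin.forall_fin_succ, -Finset.mem_compl] at start ⊢
    clear step alive hPx
    clear_value P
    grind (splits := 40)
  rcases y with j | y
  · exact reach_inl j hy
  · rcases alive (p := Sum.inl 0) (q := Sum.inl 1) (by simp) with h | h
    · exact step h hy (by simp) (reach_inl _ h)
    · exact step h hy (by simp) (reach_inl _ h)

/-- The cuts below contain at most two arcs each that are still available to a branching, so the
two arc-disjoint branchings force one another until a contradiction is reached. -/
lemma D1Arcs_not_goodPair : ¬ GoodPair (D1Arcs AW w0) (Sum.inl 2) (Sum.inl 1) := by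
  rintro ⟨O, I, hO, hI, hdisj⟩
  have excl {e} (h₁ : e ∈ O) (h₂ : e ∈ I) : False := Finset.disjoint_left.1 hdisj h₁ h₂
  have enter (T : Finset (Fin 7)) (c : Prop) (hT : 2 ∉ T) (j : Fin 7) (hj : j ∈ T) :=
    hO.exists_entering (Sum.elim (· ∈ T) fun _ => c) hT (y := Sum.inl j) hj
  have leave (T : Finset (Fin 7)) (c : Prop) (hT : 1 ∉ T) (j : Fin 7) (hj : j ∈ T) :=
    hI.exists_leaving (Sum.elim (· ∈ T) fun _ => c) hT (y := Sum.inl j) hj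
  have o016 := enter {0, 1, 6} False (by decide) 0 (by decide)
  have o0 := enter {0} False (by decide) 0 (by decide)
  have o1 := enter {1} False (by decide) 1 (by decide)
  have o16 := enter {1, 6} False (by decide) 1 (by decide)
  have o0156 := enter {0, 1, 5, 6} False (by decide) 1 (by decide)
  have o4 := enter {4} False (by decide) 4 (by decide)
  have o01356 := enter {0, 1, 3, 5, 6} True (by decide) 0 (by decide)
  have i016 := leave {2, 3, 4, 5} True (by decide) 2 (by decide)
  have i6 := leave {6} False (by decide) 6 (by decide)
  have i16 := leave {0, 2, 3, 4, 5} True (by decide) 2 (by decide)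
  have i5 := leave {5} False (by decide) 5 (by decide)
  have i35 := leave {3, 5} False (by decide) 5 (by decide)
  have i2345 := leave {2, 3, 4, 5} False (by decide) 5 (by decide)
  have i2 := leave {2} False (by decide) 2 (by decide)
  simp [Fin.exists_fin_succ] at o016 o0 o1 o16 o0156 o4 o01356 i016 i6 i16 i5 i35 i2345 i2
  grind

end D1

/-- Proposition 4.7 (for `D₁`): for every semicomplete digraph `W` and every vertex
`u_t⁺ = w0` of `W`, the split digraph `D₁ = D₁(W, u_t⁺)` (with independent set
`{u_t, w, v_t}` and semicomplete part `{b, v, u, a} ∪ V(W)`) is 2-strong and has no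
good `(u, v)`-pair. -/
theorem stmt16 {VW : Type*} [Fintype VW] [DecidableEq VW]
    (AW : Finset (VW × VW))
    (hloopW : ∀ x : VW, (x, x) ∉ AW)
    (hsemiW : ∀ x y : VW, x ≠ y → (x, y) ∈ AW ∨ (y, x) ∈ AW)
    (w0 : VW) :
    IsSplitDigraph
      ({Sum.inl 4, Sum.inl 5, Sum.inl 6} : Finset (Fin 7 ⊕ VW))
      (({Sum.inl 0, Sum.inl 1, Sum.inl 2, Sum.inl 3} : Finset (Fin 7 ⊕ VW)) ∪
        Finset.univ.image Sum.inr)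
      (D1Arcs AW w0) ∧
    KStrong 2 (D1Arcs AW w0) ∧
    ¬ GoodPair (D1Arcs AW w0) (Sum.inl 2) (Sum.inl 1) := by
  exact ⟨D1Arcs_isSplitDigraph hloopW hsemiW, D1Arcs_kStrong, D1Arcs_not_goodPair⟩
end

section
/- In the digraph D1 = D1(W, u_t⁺) (defined below, for any semicomplete digraph W and vertex u_t⁺ of W), the paths u→a→w→b→v and u→u_t→u_t⁺→v_t→v form the unique pair of arc-disjoint (u,v)-paths: if P1, P2 are any two arc-disjoint directed paths from u to v in D1, then {P1, P2} = {u a w b v, u u_t u_t⁺ v_t v}. -/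
/-- `p` is a directed path from `u` to `v` in the digraph with arc set `A`, given by
its (pairwise distinct) list of vertices. -/
def IsPath {V : Type*} (A : Finset (V × V)) (u v : V) (p : List V) : Prop :=
  List.Chain' (fun a b => (a, b) ∈ A) p ∧ p.Nodup ∧
  p.head? = some u ∧ p.getLast? = some v

/-- The list of arcs of a path given by its list of vertices. -/
def pathArcs {V : Type*} (p : List V) : List (V × V) := p.zip p.tail

section

variable {VW : Type*} [Fintype VW] [DecidableEq VW] {AW : Finset (VW × VW)} {w0 : VW}

theorem mem_D1Arcs_from_u {y : Fin 7 ⊕ VW} :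
    (Sum.inl 2, y) ∈ D1Arcs AW w0 ↔ y = Sum.inl 3 ∨ y = Sum.inl 4 := by
  simp [D1Arcs]

theorem mem_D1Arcs_from_a {y : Fin 7 ⊕ VW} :
    (Sum.inl 3, y) ∈ D1Arcs AW w0 ↔ y = Sum.inl 5 ∨ y = Sum.inl 4 := by
  simp [D1Arcs]

theorem mem_D1Arcs_from_ut {y : Fin 7 ⊕ VW} :
    (Sum.inl 4, y) ∈ D1Arcs AW w0 ↔ y = Sum.inl 2 ∨ y = Sum.inr w0 := by
  simp [D1Arcs]

theorem mem_D1Arcs_from_w {y : Fin 7 ⊕ VW} :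
    (Sum.inl 5, y) ∈ D1Arcs AW w0 ↔ y = Sum.inl 3 ∨ y = Sum.inl 0 := by
  simp [D1Arcs]

theorem mem_D1Arcs_from_vt {y : Fin 7 ⊕ VW} :
    (Sum.inl 6, y) ∈ D1Arcs AW w0 ↔ y = Sum.inl 1 ∨ y = Sum.inl 0 := by
  simp [D1Arcs]

theorem mem_D1Arcs_to_b {x : Fin 7 ⊕ VW} :
    (x, Sum.inl 0) ∈ D1Arcs AW w0 ↔ x = Sum.inl 5 ∨ x = Sum.inl 6 := by
  simp [D1Arcs]

theorem mem_D1Arcs_to_v {x : Fin 7 ⊕ VW} :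
    (x, Sum.inl 1) ∈ D1Arcs AW w0 ↔ x = Sum.inl 0 ∨ x = Sum.inl 6 := by
  simp [D1Arcs]

theorem mem_D1Arcs_to_vt {x : Fin 7 ⊕ VW} :
    (x, Sum.inl 6) ∈ D1Arcs AW w0 ↔ x = Sum.inl 1 ∨ x = Sum.inr w0 := by
  simp [D1Arcs]

@[simp]
theorem pathArcs_cons_cons {V : Type*} (x y : V) (l : List V) :
    pathArcs (x :: y :: l) = (x, y) :: pathArcs (y :: l) := rfl

theorem mem_of_mem_pathArcs {V : Type*} {x y : V} {p : List V} (h : (x, y) ∈ pathArcs p) :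
    x ∈ p ∧ y ∈ p :=
  ⟨(List.of_mem_zip h).1, List.mem_of_mem_tail (List.of_mem_zip h).2⟩

theorem IsPath.eq_singleton {V : Type*} {A : Finset (V × V)} {v : V} {p : List V}
    (h : IsPath A v v p) : p = [v] := by
  obtain ⟨-, hn, hh, hl⟩ := h
  match p with
  | [] => simp at hh
  | [x] => simpa using hh
  | x :: y :: l =>
    rw [List.getLast?_cons_cons] at hl
    have := List.mem_of_getLast? hl
    simp_all

theorem IsPath.exists_cons {V : Type*} {A : Finset (V × V)} {x v : V} {p : List V}
    (h : IsPath A x v p) (hx : x ≠ v) :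
    ∃ y q, p = x :: q ∧ (x, y) ∈ A ∧ IsPath A y v q ∧ x ∉ q ∧ (x, y) ∈ pathArcs p ∧
      ∀ e ∈ pathArcs q, e ∈ pathArcs p := by
  obtain ⟨hc, hn, hh, hl⟩ := h
  match p with
  | [] => simp at hh
  | [z] => simp_all
  | z :: y :: l =>
    obtain rfl : z = x := by simpa using hh
    have hc' := List.isChain_cons_cons.1 hc
    have hn' := List.nodup_cons.1 hn
    exact ⟨y, y :: l, rfl, hc'.1, ⟨hc'.2, hn'.2, rfl, by rwa [List.getLast?_cons_cons] at hl⟩,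
      hn'.1, by simp, by simp +contextual⟩

theorem IsPath.mem_source {V : Type*} {A : Finset (V × V)} {x v : V} {p : List V}
    (h : IsPath A x v p) : x ∈ p :=
  List.mem_of_head? h.2.2.1

/-- The only arcs entering `{b, v, v_t}` are `w → b` and `u_t⁺ → v_t`. -/
theorem IsPath.entering_arc {x : Fin 7 ⊕ VW} {p : List (Fin 7 ⊕ VW)}
    (h : IsPath (D1Arcs AW w0) x (Sum.inl 1) p)
    (h0 : x ≠ Sum.inl 0) (h1 : x ≠ Sum.inl 1) (h6 : x ≠ Sum.inl 6) :
    (Sum.inl 5, Sum.inl 0) ∈ pathArcs p ∨ (Sum.inr w0, Sum.inl 6) ∈ pathArcs p := by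
  induction p generalizing x with
  | nil => simp [IsPath] at h
  | cons z l ih =>
    obtain ⟨y, q, hq, ha, hp, -, hxy, hsub⟩ := h.exists_cons h1
    obtain ⟨rfl, rfl⟩ := List.cons.inj hq
    by_cases y0 : y = Sum.inl 0
    · subst y0
      rcases mem_D1Arcs_to_b.1 ha with rfl | rfl <;> simp_all
    by_cases y1 : y = Sum.inl 1
    · subst y1
      rcases mem_D1Arcs_to_v.1 ha with rfl | rfl <;> simp_all
    by_cases y6 : y = Sum.inl 6
    · subst y6
      rcases mem_D1Arcs_to_vt.1 ha with rfl | rfl <;> simp_all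
    exact (ih hp y0 y1 y6).imp (hsub _) (hsub _)

/-- A path to `v` that starts at `u_t` without returning to `u` continues with `u_t⁺`. -/
theorem IsPath.exists_cons_of_ut {p : List (Fin 7 ⊕ VW)}
    (h : IsPath (D1Arcs AW w0) (Sum.inl 4) (Sum.inl 1) p) (hu : Sum.inl 2 ∉ p) :
    ∃ q, p = Sum.inl 4 :: q ∧ IsPath (D1Arcs AW w0) (Sum.inr w0) (Sum.inl 1) q ∧
      (Sum.inl 4, Sum.inr w0) ∈ pathArcs p := by
  obtain ⟨y, q, rfl, ha, hq, -, harc, -⟩ := h.exists_cons (by simp)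
  have := hq.mem_source
  rcases mem_D1Arcs_from_ut.1 ha with rfl | rfl
  · simp_all
  · exact ⟨q, rfl, hq, harc⟩

theorem eq_of_starts_a_of_starts_ut {q₁ q₂ : List (Fin 7 ⊕ VW)}
    (h₁ : IsPath (D1Arcs AW w0) (Sum.inl 3) (Sum.inl 1) q₁) (hu₁ : Sum.inl 2 ∉ q₁)
    (h₂ : IsPath (D1Arcs AW w0) (Sum.inl 4) (Sum.inl 1) q₂) (hu₂ : Sum.inl 2 ∉ q₂)
    (hdisj : ∀ e ∈ pathArcs q₁, e ∉ pathArcs q₂) :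
    q₁ = [Sum.inl 3, Sum.inl 5, Sum.inl 0, Sum.inl 1] ∧
      q₂ = [Sum.inl 4, Sum.inr w0, Sum.inl 6, Sum.inl 1] := by
  have entry := h₂.entering_arc (by simp) (by simp) (by simp)
  obtain ⟨r₂, rfl, hr₂, harc₂⟩ := h₂.exists_cons_of_ut hu₂
  obtain ⟨y, r₁, rfl, hy, hr₁, ha, -, hs₁⟩ := h₁.exists_cons (by simp)
  rcases mem_D1Arcs_from_a.1 hy with rfl | rfl
  swap
  · obtain ⟨_, -, -, harc₁⟩ := hr₁.exists_cons_of_ut (by simp_all)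
    exact absurd harc₂ (hdisj _ (hs₁ _ harc₁))
  obtain ⟨y, s₁, rfl, hy', hs, hw, hwb, hs₂⟩ := hr₁.exists_cons (by simp)
  have hms := hs.mem_source
  rcases mem_D1Arcs_from_w.1 hy' with rfl | rfl
  · simp_all
  have hvt := entry.resolve_left (hdisj _ (hs₁ _ hwb))
  obtain ⟨y, t₁, rfl, hy₁, ht₁, hb, hby, hs₃⟩ := hs.exists_cons (by simp)
  have hy₁v : y = Sum.inl 1 := by
    by_contra hne
    have hy6 : y ≠ Sum.inl 6 := by
      rintro rfl
      rcases mem_D1Arcs_to_vt.1 hy₁ with h | h <;> simp at h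
    have hy0 : y ≠ Sum.inl 0 := by
      rintro rfl
      exact hb ht₁.mem_source
    rcases ht₁.entering_arc hy0 hne hy6 with h | h
    · exact hb (mem_of_mem_pathArcs h).2
    · exact hdisj _ (hs₁ _ (hs₂ _ (hs₃ _ h))) hvt
  subst hy₁v
  obtain rfl := ht₁.eq_singleton
  obtain ⟨z, r, rfl, -, hr, hw0, -, -⟩ := hr₂.exists_cons (by simp)
  have hz6 : z = Sum.inl 6 := by
    match r, hr.2.2.1 with
    | z' :: l, hzl =>
      obtain rfl : z' = z := by simpa using hzl
      simp only [pathArcs_cons_cons, List.mem_cons, Prod.mk.injEq, reduceCtorEq, false_and,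
        true_and, false_or] at hvt
      rcases hvt with h | h
      · exact h.symm
      · exact absurd (mem_of_mem_pathArcs h).1 hw0
  subst hz6
  obtain ⟨z, t, rfl, hz, ht, h6, -, -⟩ := hr.exists_cons (by simp)
  rcases mem_D1Arcs_from_vt.1 hz with rfl | rfl
  · obtain rfl := ht.eq_singleton
    exact ⟨rfl, rfl⟩
  obtain ⟨z, t', rfl, -, ht', h0, -, -⟩ := ht.exists_cons (by simp)
  have hmz := ht'.mem_source
  exfalso
  by_cases hz1 : z = Sum.inl 1
  · subst hz1
    refine hdisj (Sum.inl 0, Sum.inl 1) (by simp) ?_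
    match t', ht'.2.2.1 with
    | z' :: l, hzl =>
      obtain rfl : z' = Sum.inl 1 := by simpa using hzl
      simp
  · rcases ht'.entering_arc (by rintro rfl; exact h0 hmz) hz1
      (by rintro rfl; exact h6 (List.mem_cons_of_mem _ hmz)) with h | h
    · exact h0 (mem_of_mem_pathArcs h).2
    · exact h6 (List.mem_cons_of_mem _ (mem_of_mem_pathArcs h).2)

end

/-- In `D₁ = D₁(W, u_t⁺)`, the paths `u a w b v` and `u u_t u_t⁺ v_t v` form the
unique pair of arc-disjoint `(u, v)`-paths. -/
theorem stmt17 {VW : Type*} [Fintype VW] [DecidableEq VW]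
    (AW : Finset (VW × VW))
    (hloopW : ∀ x : VW, (x, x) ∉ AW)
    (hsemiW : ∀ x y : VW, x ≠ y → (x, y) ∈ AW ∨ (y, x) ∈ AW)
    (w0 : VW)
    (p₁ p₂ : List (Fin 7 ⊕ VW))
    (h₁ : IsPath (D1Arcs AW w0) (Sum.inl 2) (Sum.inl 1) p₁)
    (h₂ : IsPath (D1Arcs AW w0) (Sum.inl 2) (Sum.inl 1) p₂)
    (hdisj : ∀ e ∈ pathArcs p₁, e ∉ pathArcs p₂) :
    ({p₁, p₂} : Set (List (Fin 7 ⊕ VW))) =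
      {[Sum.inl 2, Sum.inl 3, Sum.inl 5, Sum.inl 0, Sum.inl 1],
       [Sum.inl 2, Sum.inl 4, Sum.inr w0, Sum.inl 6, Sum.inl 1]} := by
  obtain ⟨y₁, q₁, rfl, ha₁, hq₁, hu₁, harc₁, hs₁⟩ := h₁.exists_cons (by simp)
  obtain ⟨y₂, q₂, rfl, ha₂, hq₂, hu₂, harc₂, hs₂⟩ := h₂.exists_cons (by simp)
  have hd : ∀ e ∈ pathArcs q₁, e ∉ pathArcs q₂ :=
    fun e h h' => hdisj e (hs₁ e h) (hs₂ e h')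
  rcases mem_D1Arcs_from_u.1 ha₁ with rfl | rfl <;>
    rcases mem_D1Arcs_from_u.1 ha₂ with rfl | rfl
  · exact absurd harc₂ (hdisj _ harc₁)
  · obtain ⟨rfl, rfl⟩ := eq_of_starts_a_of_starts_ut hq₁ hu₁ hq₂ hu₂ hd
    rfl
  · obtain ⟨rfl, rfl⟩ :=
      eq_of_starts_a_of_starts_ut hq₂ hu₂ hq₁ hu₁ fun e h h' => hd e h' h
    exact Set.pair_comm _ _
  · exact absurd harc₂ (hdisj _ harc₁)
end

section
/- For every positive integer n there exists a 2-strong split digraph D with more than n vertices and vertices u, v of D such that D has no good (u,v)-pair. -/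
/-- The arcs of a split digraph on `ℕ`, whose restriction to `{0, …, m - 1}` is studied below
for `m ≥ 8`. The independent part is `{4, 5}`, and the vertices from `6` on form a complete
digraph that dominates `1` and `3`, is dominated by `0` and `2`, and is joined to the
independent part by the arcs `(4, 7)` and `(7, 5)` only. -/
def SplitArc (i j : ℕ) : Prop :=
  i = 0 ∧ (j = 2 ∨ j = 3) ∨ i = 1 ∧ (j = 0 ∨ j = 4) ∨ i = 2 ∧ (j = 1 ∨ j = 3 ∨ j = 5) ∨
  i = 3 ∧ (j = 1 ∨ j = 4) ∨ i = 4 ∧ (j = 3 ∨ j = 7) ∨ i = 5 ∧ (j = 0 ∨ j = 2) ∨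
  i = 7 ∧ j = 5 ∨ (i = 0 ∨ i = 2) ∧ 6 ≤ j ∨ 6 ≤ i ∧ (j = 1 ∨ j = 3) ∨
  6 ≤ i ∧ 6 ≤ j ∧ i ≠ j

instance : DecidableRel SplitArc := fun _ _ => by unfold SplitArc; infer_instance

/-- The arc set of the restriction of `SplitArc` to `{0, …, m - 1}`. -/
def splitArcs (m : ℕ) : Finset (Fin m × Fin m) :=
  Finset.univ.filter fun e => SplitArc e.1 e.2

theorem mem_splitArcs {m : ℕ} {x y : Fin m} : (x, y) ∈ splitArcs m ↔ SplitArc x y := by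
  simp [splitArcs]

/-- A path that starts inside `p` and ends outside `p` uses an arc leaving `p`. -/
theorem Relation.ReflTransGen.exists_leaving {α : Type*} {r : α → α → Prop} {a b : α}
    (h : Relation.ReflTransGen r a b) (p : α → Prop) (ha : p a) (hb : ¬ p b) :
    ∃ x y, r x y ∧ p x ∧ ¬ p y := by
  induction h with
  | refl => exact absurd ha hb
  | @tail c d _ hcd ih =>
    by_cases hc : p c
    · exact ⟨c, d, hcd, hc, hb⟩
    · exact ih hc

/-- Any two entries of a list that is closed under `r`-steps from each entry to the next,
cyclically, are joined by an `r`-path. -/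
theorem List.IsChain.reflTransGen_of_append_self {α : Type*} {r : α → α → Prop} {l : List α}
    (h : (l ++ l).IsChain r) {a b : α} (ha : a ∈ l) (hb : b ∈ l) :
    Relation.ReflTransGen r a b := by
  have h' : (l ++ l).IsChain (Relation.ReflTransGen r) :=
    h.imp fun _ _ => Relation.ReflTransGen.single
  exact (List.pairwise_append.mp h'.pairwise).2.2 a ha b hb

/-- A closed walk of `SplitArc` through all vertices below `8` other than `w`. -/
def tour : ℕ → List ℕ
  | 0 => [1, 4, 7, 5, 2, 6, 3]
  | 1 => [0, 2, 6, 3, 4, 7, 5]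
  | 2 => [0, 6, 3, 1, 4, 7, 5]
  | 3 => [0, 2, 6, 1, 4, 7, 5]
  | 4 => [0, 6, 7, 5, 2, 3, 1]
  | 5 => [0, 2, 3, 4, 7, 6, 1]
  | 6 => [0, 2, 3, 1, 4, 7, 5]
  | _ => [0, 6, 1, 4, 3, 1, 0, 2, 5]

theorem tour_isChain : ∀ w < 8, (tour w ++ tour w).IsChain SplitArc := by decide

theorem mem_tour : ∀ w < 8, ∀ a < 8, a ∈ tour w ↔ a ≠ w := by decide

/-- Two vertices below `8` remain connected after deletion of one further vertex. -/
theorem reflTransGen_core {w a b : ℕ} (ha : a < 8) (hb : b < 8) (haw : a ≠ w) (hbw : b ≠ w) :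
    Relation.ReflTransGen (fun i j => i < 8 ∧ j < 8 ∧ i ≠ w ∧ j ≠ w ∧ SplitArc i j) a b := by
  obtain ⟨z, hz, haz, hbz, hzw⟩ :
      ∃ z < 8, a ≠ z ∧ b ≠ z ∧ ∀ c < 8, c ≠ z → c ≠ w := by
    by_cases hw : w < 8
    · exact ⟨w, hw, haw, hbw, fun _ _ h => h⟩
    · obtain ⟨z, hz, h⟩ : ∃ z < 8, a ≠ z ∧ b ≠ z := by
        by_contra! h
        have h0 := h 0
        have h1 := h 1
        have h2 := h 2
        omega
      exact ⟨z, hz, h.1, h.2, fun c hc _ => by omega⟩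
  have hlt : ∀ c ∈ tour z, c < 8 := by
    have : ∀ z < 8, ∀ c ∈ tour z, c < 8 := by decide
    exact this z hz
  have hmem : ∀ c ∈ tour z ++ tour z, c ∈ tour z := by simp
  refine List.IsChain.reflTransGen_of_append_self (l := tour z) ?_
    ((mem_tour z hz a ha).2 haz) ((mem_tour z hz b hb).2 hbz)
  refine (tour_isChain z hz).imp_of_mem_imp fun i j hi hj hij => ?_
  have hi := hmem i hi
  have hj := hmem j hj
  have hi8 := hlt i hi
  have hj8 := hlt j hj
  exact ⟨hi8, hj8, hzw i hi8 ((mem_tour z hz i hi8).1 hi),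
    hzw j hj8 ((mem_tour z hz j hj8).1 hj), hij⟩

/-- Every vertex avoiding `w` reaches a vertex below `8`, also avoiding `w`, in at most one
step, and is reached from such a vertex in at most one step. -/
theorem exists_core_neighbors (a w : ℕ) (haw : a ≠ w) :
    (∃ c < 8, c ≠ w ∧ (a = c ∨ SplitArc a c)) ∧ ∃ c < 8, c ≠ w ∧ (a = c ∨ SplitArc c a) := by
  by_cases ha : a < 8
  · exact ⟨⟨a, ha, haw, .inl rfl⟩, a, ha, haw, .inl rfl⟩
  · constructor
    · by_cases hw : w = 1
      · exact ⟨3, by omega, by omega, .inr (by unfold SplitArc; omega)⟩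
      · exact ⟨1, by omega, by omega, .inr (by unfold SplitArc; omega)⟩
    · by_cases hw : w = 0
      · exact ⟨2, by omega, by omega, .inr (by unfold SplitArc; omega)⟩
      · exact ⟨0, by omega, by omega, .inr (by unfold SplitArc; omega)⟩

theorem kStrong_splitArcs {m : ℕ} (hm : 8 ≤ m) : KStrong 2 (splitArcs m) := by
  refine ⟨by simp; omega, fun X hX x hx y hy => ?_⟩
  have hxX : x ∉ X := by simpa using hx
  have hyX : y ∉ X := by simpa using hy
  -- `w = m` serves when no vertex is deleted.
  obtain ⟨w, hw, hxw, hyw⟩ :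
      ∃ w : ℕ, (∀ z : Fin m, (z : ℕ) ≠ w → z ∉ X) ∧ (x : ℕ) ≠ w ∧ (y : ℕ) ≠ w := by
    obtain rfl | ⟨w, hwX⟩ := X.eq_empty_or_nonempty
    · exact ⟨m, by simp, x.2.ne, y.2.ne⟩
    · refine ⟨w, fun z hzw hz => hzw ?_, fun h => hxX ?_, fun h => hyX ?_⟩
      · rw [Finset.card_le_one.1 (by omega) z hz w hwX]
      · rwa [Fin.ext h]
      · rwa [Fin.ext h]
  set r : Fin m → Fin m → Prop := fun a b => a ∈ Xᶜ ∧ b ∈ Xᶜ ∧ (a, b) ∈ splitArcs m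
  have step (a b : Fin m) (haw : (a : ℕ) ≠ w) (hbw : (b : ℕ) ≠ w)
      (hab : a = b ∨ SplitArc a b) : Relation.ReflTransGen r a b := by
    obtain rfl | hab := hab
    · exact .refl
    · exact .single ⟨by simpa using hw a haw, by simpa using hw b hbw, mem_splitArcs.2 hab⟩
  obtain ⟨c, hc, hcw, hxc⟩ := (exists_core_neighbors x w hxw).1
  obtain ⟨d, hd, hdw, hyd⟩ := (exists_core_neighbors y w hyw).2
  have core : Relation.ReflTransGen r ⟨c, by omega⟩ ⟨d, by omega⟩ := by
    have key (e : ℕ) (h : Relation.ReflTransGen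
        (fun i j => i < 8 ∧ j < 8 ∧ i ≠ w ∧ j ≠ w ∧ SplitArc i j) c e) (he : e < m) :
        Relation.ReflTransGen r ⟨c, by omega⟩ ⟨e, he⟩ := by
      induction h with
      | refl => exact .refl
      | tail _ h ih =>
        obtain ⟨hi, _, hiw, hjw, hij⟩ := h
        exact (ih (by omega)).trans (step _ _ hiw hjw (.inr hij))
    exact key d (reflTransGen_core hc hd hcw hdw) _
  refine ((step x ⟨c, by omega⟩ hxw hcw ?_).trans core).trans
    (step ⟨d, by omega⟩ y hdw hyw ?_)
  · exact hxc.imp_left fun h => Fin.ext h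
  · exact hyd.imp_left fun h => Fin.ext h.symm

theorem isSplitDigraph_splitArcs {m : ℕ} (hm : 8 ≤ m) :
    IsSplitDigraph (Finset.univ.filter fun x : Fin m => (x : ℕ) = 4 ∨ (x : ℕ) = 5)
      (Finset.univ.filter fun x : Fin m => ¬ ((x : ℕ) = 4 ∨ (x : ℕ) = 5)) (splitArcs m) := by
  refine ⟨⟨⟨4, by omega⟩, by simp⟩, ⟨⟨0, by omega⟩, by simp⟩,
    Finset.disjoint_filter_filter_not _ _ _, Finset.filter_union_filter_not_eq _ _,
    fun v => ?_, fun u hu v hv => ?_, fun u hu v hv huv => ?_⟩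
  · rw [mem_splitArcs]
    unfold SplitArc
    omega
  · simp only [Finset.mem_filter, Finset.mem_univ, true_and] at hu hv
    rw [mem_splitArcs]
    unfold SplitArc
    omega
  · simp only [Finset.mem_filter, Finset.mem_univ, true_and] at hu hv
    have huv' : (u : ℕ) ≠ v := fun h => huv (Fin.ext h)
    rw [mem_splitArcs, mem_splitArcs]
    have class_of (a : ℕ) (ha : ¬ (a = 4 ∨ a = 5)) : a = 0 ∨ a = 1 ∨ a = 2 ∨ a = 3 ∨ 6 ≤ a := by
      omega
    generalize (u : ℕ) = a at *
    generalize (v : ℕ) = b at *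
    unfold SplitArc
    obtain rfl | rfl | rfl | rfl | ha := class_of a hu <;>
      obtain rfl | rfl | rfl | rfl | hb := class_of b hv <;> grind

theorem not_goodPair_splitArcs {m : ℕ} (hm : 8 ≤ m) :
    ¬ GoodPair (splitArcs m) ⟨3, by omega⟩ ⟨2, by omega⟩ := by
  rintro ⟨B₁, B₂, ⟨hB₁, hout, -, -⟩, ⟨hB₂, hin, -, -⟩, hdisj⟩
  let b₁ : ℕ → ℕ → Prop := fun i j => ∃ x y : Fin m, (x, y) ∈ B₁ ∧ (x : ℕ) = i ∧ (y : ℕ) = j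
  let b₂ : ℕ → ℕ → Prop := fun i j => ∃ x y : Fin m, (x, y) ∈ B₂ ∧ (x : ℕ) = i ∧ (y : ℕ) = j
  have hd : ∀ i j, b₁ i j → ¬ b₂ i j := by
    rintro i j ⟨x, y, h₁, rfl, rfl⟩ ⟨x', y', h₂, hx, hy⟩
    obtain rfl := Fin.ext hx
    obtain rfl := Fin.ext hy
    exact Finset.disjoint_left.1 hdisj h₁ h₂
  have enters (k : ℕ) (p : ℕ → Prop) {a b c d : ℕ} (hk : k < m) (h3 : p 3) (hkp : ¬ p k)
      (hp : ∀ i j, SplitArc i j → p i → ¬ p j → i = a ∧ j = b ∨ i = c ∧ j = d) :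
      b₁ a b ∨ b₁ c d := by
    obtain ⟨x, y, hxy, hx, hy⟩ := (hout ⟨k, hk⟩).exists_leaving (fun z => p z) h3 hkp
    exact (hp x y (mem_splitArcs.1 (hB₁ hxy)) hx hy).imp
      (fun h => ⟨x, y, hxy, h⟩) fun h => ⟨x, y, hxy, h⟩
  have leaves (k : ℕ) (p : ℕ → Prop) {a b c d : ℕ} (hk : k < m) (hkp : p k) (h2 : ¬ p 2)
      (hp : ∀ i j, SplitArc i j → p i → ¬ p j → i = a ∧ j = b ∨ i = c ∧ j = d) :
      b₂ a b ∨ b₂ c d := by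
    obtain ⟨x, y, hxy, hx, hy⟩ := (hin ⟨k, hk⟩).exists_leaving (fun z => p z) hkp h2
    exact (hp x y (mem_splitArcs.1 (hB₂ hxy)) hx hy).imp
      (fun h => ⟨x, y, hxy, h⟩) fun h => ⟨x, y, hxy, h⟩
  have h025 : b₁ 1 0 ∨ b₁ 7 5 :=
    enters 0 (fun i => i ≠ 0 ∧ i ≠ 2 ∧ i ≠ 5) (by omega) (by omega) (by omega)
      (by unfold SplitArc; omega)
  have h0 : b₁ 1 0 ∨ b₁ 5 0 :=
    enters 0 (fun i => i ≠ 0) (by omega) (by omega) (by omega)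
      (by unfold SplitArc; omega)
  have h2 : b₁ 0 2 ∨ b₁ 5 2 :=
    enters 2 (fun i => i ≠ 2) (by omega) (by omega) (by omega)
      (by unfold SplitArc; omega)
  have h4 : b₁ 1 4 ∨ b₁ 3 4 :=
    enters 4 (fun i => i ≠ 4) (by omega) (by omega) (by omega)
      (by unfold SplitArc; omega)
  have h34 : b₁ 3 1 ∨ b₁ 4 7 :=
    enters 0 (fun i => i = 3 ∨ i = 4) (by omega) (by omega) (by omega)
      (by unfold SplitArc; omega)
  have g134 : b₂ 1 0 ∨ b₂ 4 7 :=
    leaves 1 (fun i => i = 1 ∨ i = 3 ∨ i = 4) (by omega) (by omega) (by omega)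
      (by unfold SplitArc; omega)
  have g1 : b₂ 1 0 ∨ b₂ 1 4 :=
    leaves 1 (fun i => i = 1) (by omega) (by omega) (by omega)
      (by unfold SplitArc; omega)
  have g3 : b₂ 3 1 ∨ b₂ 3 4 :=
    leaves 3 (fun i => i = 3) (by omega) (by omega) (by omega)
      (by unfold SplitArc; omega)
  have g5 : b₂ 5 0 ∨ b₂ 5 2 :=
    leaves 5 (fun i => i = 5) (by omega) (by omega) (by omega)
      (by unfold SplitArc; omega)
  have g25 : b₂ 0 2 ∨ b₂ 7 5 :=
    leaves 0 (fun i => i ≠ 2 ∧ i ≠ 5) (by omega) (by omega) (by omega)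
      (by unfold SplitArc; omega)
  by_cases h10 : b₁ 1 0
  · have g47 := g134.resolve_left (hd _ _ h10)
    have g14 := g1.resolve_left (hd _ _ h10)
    have h34' := h4.resolve_left fun h => hd _ _ h g14
    have g31 := g3.resolve_right (hd _ _ h34')
    exact h34.elim (fun h => hd _ _ h g31) fun h => hd _ _ h g47
  · have h75 := h025.resolve_left h10
    have h50 := h0.resolve_left h10
    have g52 := g5.resolve_left (hd _ _ h50)
    have h02 := h2.resolve_right fun h => hd _ _ h g52
    exact g25.elim (hd _ _ h02) (hd _ _ h75)

/-- Proposition 4.8: for every `n` there is a 2-strong split digraph on more than `n`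
vertices having no good `(u, v)`-pair for some choice of `u, v`. -/
theorem stmt18 (n : ℕ) (hn : 0 < n) :
    ∃ (m : ℕ) (V₁ V₂ : Finset (Fin m)) (A : Finset (Fin m × Fin m)) (u v : Fin m),
      n < m ∧ IsSplitDigraph V₁ V₂ A ∧ KStrong 2 A ∧ ¬ GoodPair A u v := by
    exact ⟨n + 8, _, _, splitArcs (n + 8), ⟨3, by omega⟩, ⟨2, by omega⟩, by omega,
    isSplitDigraph_splitArcs (by omega), kStrong_splitArcs (by omega),
    not_goodPair_splitArcs (by omega)⟩
end

section
/- For every positive integer n there exists a 2-strong split digraph with more than n vertices that has no strong arc decomposition. -/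
/-- The arc relation on vertex labels: the labels `≥ 3` form a complete digraph that dominates
`1` and `2`, and the only other arcs are `1 → 2`, `1 → 0`, `0 → 1`, `2 → 0`, `0 → 3`, `2 → 4`. -/
def hubArc (a b : ℕ) : Prop :=
  (3 ≤ a ∧ 1 ≤ b ∧ a ≠ b) ∨ (a = 1 ∧ b = 2) ∨ (a = 1 ∧ b = 0) ∨ (a = 0 ∧ b = 1) ∨
    (a = 2 ∧ b = 0) ∨ (a = 0 ∧ b = 3) ∨ (a = 2 ∧ b = 4)

instance (a b : ℕ) : Decidable (hubArc a b) := by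
  unfold hubArc; infer_instance

/-- The arc set on `Fin m` given by `hubArc`. -/
def hubArcs (m : ℕ) : Finset (Fin m × Fin m) :=
  Finset.univ.filter fun e => hubArc e.1 e.2

lemma mem_hubArcs {m : ℕ} {a b : Fin m} : (a, b) ∈ hubArcs m ↔ hubArc a b := by
  simp [hubArcs]

/-- In a strong digraph some arc leaves every proper nonempty set of vertices. -/
lemma DigraphStrong.exists_arc_leaving {V : Type*} {A : Finset (V × V)} (h : DigraphStrong A)
    (P : V → Prop) {x y : V} (hx : P x) (hy : ¬ P y) :
    ∃ a b, (a, b) ∈ A ∧ P a ∧ ¬ P b := by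
  by_contra! hc
  have key : ∀ z, Relation.ReflTransGen (fun a b => (a, b) ∈ A) x z → P z := by
    intro z hz
    induction hz with
    | refl => exact hx
    | tail _ hab ih => exact hc _ _ hab ih
  exact hy (key y (h x y))

lemma isSplitDigraph_hubArcs (k : ℕ) :
    IsSplitDigraph {(0 : Fin (k + 6))} {(0 : Fin (k + 6))}ᶜ (hubArcs (k + 6)) := by
  refine ⟨by simp, ⟨1, by simp⟩, disjoint_compl_right, by simp, ?_, ?_, ?_⟩
  · intro v
    rw [mem_hubArcs, hubArc]
    omega
  · intro u hu v hv
    simp only [Finset.mem_singleton, Fin.ext_iff, Fin.val_zero] at hu hv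
    rw [mem_hubArcs, hubArc]
    omega
  · intro u hu v hv huv
    simp only [Finset.mem_compl, Finset.mem_singleton, Fin.ext_iff, Fin.val_zero] at hu hv huv
    rw [mem_hubArcs, mem_hubArcs]
    by_cases hu3 : 3 ≤ u.val
    · exact .inl (.inl ⟨hu3, by omega, by omega⟩)
    by_cases hv3 : 3 ≤ v.val
    · exact .inr (.inl ⟨hv3, by omega, by omega⟩)
    obtain h | h : (u.val = 1 ∧ v.val = 2) ∨ (v.val = 1 ∧ u.val = 2) := by omega
    · exact .inl (.inr (.inl h))
    · exact .inr (.inr (.inl h))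

lemma kStrong_two_hubArcs (k : ℕ) : KStrong 2 (hubArcs (k + 6)) := by
  refine ⟨by simp, fun X hX => ?_⟩
  obtain ⟨x₀, hx₀⟩ : ∃ x₀ : ℕ, ∀ y : Fin (k + 6), y.val ≠ x₀ → y ∈ Xᶜ := by
    rcases Finset.card_le_one_iff_subset_singleton.1 (Nat.lt_succ_iff.1 hX) with ⟨x, hx⟩
    refine ⟨x, fun y hy => Finset.mem_compl.2 fun hyX => hy ?_⟩
    rw [Finset.mem_singleton.1 (hx hyX)]
  have hstep : ∀ a b : Fin (k + 6), a ∈ Xᶜ → b ∈ Xᶜ → hubArc a b →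
      Relation.ReflTransGen (fun a b => a ∈ Xᶜ ∧ b ∈ Xᶜ ∧ (a, b) ∈ hubArcs (k + 6)) a b :=
    fun a b ha hb hab => .single ⟨ha, hb, mem_hubArcs.2 hab⟩
  generalize hR : Relation.ReflTransGen
    (fun a b => a ∈ Xᶜ ∧ b ∈ Xᶜ ∧ (a, b) ∈ hubArcs (k + 6)) = R at hstep
  have htrans : ∀ {a b c}, R a b → R b c → R a c := by
    subst hR; exact fun h₁ h₂ => h₁.trans h₂
  have hrefl : ∀ a, R a a := by
    subst hR; exact fun a => .refl
  obtain ⟨v, hv⟩ : ∃ v : Fin (k + 6), v.val = 0 := ⟨⟨0, by omega⟩, rfl⟩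
  obtain ⟨p, hp⟩ : ∃ p : Fin (k + 6), p.val = 1 := ⟨⟨1, by omega⟩, rfl⟩
  obtain ⟨q, hq⟩ : ∃ q : Fin (k + 6), q.val = 2 := ⟨⟨2, by omega⟩, rfl⟩
  obtain ⟨w, hw⟩ : ∃ w : Fin (k + 6), w.val = 3 := ⟨⟨3, by omega⟩, rfl⟩
  obtain ⟨f, hf⟩ : ∃ f : Fin (k + 6), f.val = 4 := ⟨⟨4, by omega⟩, rfl⟩
  obtain ⟨h, hh, hhx⟩ : ∃ h : Fin (k + 6), 3 ≤ h.val ∧ h.val ≠ x₀ := by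
    by_cases h3 : x₀ = 3
    · exact ⟨f, by omega, by omega⟩
    · exact ⟨w, by omega, by omega⟩
  have hhX := hx₀ h hhx
  have hbig : ∀ y ∈ Xᶜ, 3 ≤ y.val → R y h := by
    intro y hy h3
    by_cases hyh : y = h
    · exact hyh ▸ hrefl y
    · rw [Fin.ext_iff] at hyh
      exact hstep _ _ hy hhX (by unfold hubArc; omega)
  have hfrom : ∀ y ∈ Xᶜ, R h y := by
    intro y hy
    by_cases hyh : h = y
    · exact hyh ▸ hrefl h
    rw [Fin.ext_iff] at hyh
    by_cases hy0 : y.val = 0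
    · by_cases h1 : x₀ = 1
      · have hqX := hx₀ q (by omega)
        exact htrans (hstep h q hhX hqX (by unfold hubArc; omega))
          (hstep q y hqX hy (by unfold hubArc; omega))
      · have hpX := hx₀ p (by omega)
        exact htrans (hstep h p hhX hpX (by unfold hubArc; omega))
          (hstep p y hpX hy (by unfold hubArc; omega))
    · exact hstep _ _ hhX hy (by unfold hubArc; omega)
  have hto_of_v : x₀ ≠ 3 → ∀ y ∈ Xᶜ, y.val = 0 → R y h := by
    intro h3 y hy hy0
    have hwX := hx₀ w (by omega)
    exact htrans (hstep y w hy hwX (by unfold hubArc; omega)) (hbig w hwX (by omega))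
  have hto_of_q : ∀ y ∈ Xᶜ, y.val = 2 → R y h := by
    intro y hy hy2
    by_cases h4 : x₀ = 4
    · have hvX := hx₀ v (by omega)
      exact htrans (hstep y v hy hvX (by unfold hubArc; omega)) (hto_of_v (by omega) v hvX hv)
    · have hfX := hx₀ f (by omega)
      exact htrans (hstep y f hy hfX (by unfold hubArc; omega)) (hbig f hfX (by omega))
  have hto_of_p : ∀ y ∈ Xᶜ, y.val = 1 → R y h := by
    intro y hy hy1
    by_cases h2 : x₀ = 2
    · have hvX := hx₀ v (by omega)
      exact htrans (hstep y v hy hvX (by unfold hubArc; omega)) (hto_of_v (by omega) v hvX hv)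
    · have hqX := hx₀ q (by omega)
      exact htrans (hstep y q hy hqX (by unfold hubArc; omega)) (hto_of_q q hqX hq)
  have hto : ∀ y ∈ Xᶜ, R y h := by
    intro y hy
    by_cases h3 : 3 ≤ y.val
    · exact hbig y hy h3
    obtain h0 | h1 | h2 : y.val = 0 ∨ y.val = 1 ∨ y.val = 2 := by omega
    · by_cases hx3 : x₀ = 3
      · have hpX := hx₀ p (by omega)
        exact htrans (hstep y p hy hpX (by unfold hubArc; omega)) (hto_of_p p hpX hp)
      · exact hto_of_v hx3 y hy h0
    · exact hto_of_p y hy h1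
    · exact hto_of_q y hy h2
  intro x hx y hy
  rw [hR]
  exact htrans (hto x hx) (hfrom y hy)

/-- The small cuts of `hubArcs`, seen by a strong spanning subdigraph. -/
lemma DigraphStrong.hubArcs_cuts {k : ℕ} {C : Finset (Fin (k + 6) × Fin (k + 6))}
    (hC : C ⊆ hubArcs (k + 6)) (hs : DigraphStrong C) {v p q w f : Fin (k + 6)}
    (hv : v.val = 0) (hp : p.val = 1) (hq : q.val = 2) (hw : w.val = 3) (hf : f.val = 4) :
    ((v, w) ∈ C ∨ (q, f) ∈ C) ∧ ((q, v) ∈ C ∨ (q, f) ∈ C) ∧ ((p, v) ∈ C ∨ (q, v) ∈ C) ∧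
      ((v, p) ∈ C ∨ (v, w) ∈ C) ∧ ((p, q) ∈ C ∨ (v, w) ∈ C) ∧ ((p, q) ∈ C ∨ (p, v) ∈ C) := by
  have hcut : ∀ (P : ℕ → Prop) (x y : Fin (k + 6)) (a b c d : Fin (k + 6)), P x → ¬ P y →
      (∀ i j, hubArc i j → P i → ¬ P j → (i = a ∧ j = b) ∨ (i = c ∧ j = d)) →
      (a, b) ∈ C ∨ (c, d) ∈ C := by
    intro P x y a b c d hx hy hP
    obtain ⟨i, j, hij, hi, hj⟩ := hs.exists_arc_leaving (fun z => P z.val) hx hy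
    rcases hP i j (mem_hubArcs.1 (hC hij)) hi hj with ⟨h₁, h₂⟩ | ⟨h₁, h₂⟩
    · rw [Fin.ext h₁, Fin.ext h₂] at hij
      exact .inl hij
    · rw [Fin.ext h₁, Fin.ext h₂] at hij
      exact .inr hij
  refine ⟨hcut (· < 3) v w _ _ _ _ ?_ ?_ ?_, hcut (· = 2) q v _ _ _ _ ?_ ?_ ?_,
    hcut (· ≠ 0) q v _ _ _ _ ?_ ?_ ?_, hcut (· = 0) v q _ _ _ _ ?_ ?_ ?_,
    hcut (· < 2) v q _ _ _ _ ?_ ?_ ?_, hcut (· = 1) p q _ _ _ _ ?_ ?_ ?_⟩ <;>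
  first | omega | (intro i j hij hi hj; unfold hubArc at hij; omega)

lemma not_strongArcDecomp_hubArcs (k : ℕ) : ¬ StrongArcDecomp (hubArcs (k + 6)) := by
  rintro ⟨A₁, A₂, hU, hD, h₁, h₂⟩
  obtain ⟨v, hv⟩ : ∃ v : Fin (k + 6), v.val = 0 := ⟨⟨0, by omega⟩, rfl⟩
  obtain ⟨p, hp⟩ : ∃ p : Fin (k + 6), p.val = 1 := ⟨⟨1, by omega⟩, rfl⟩
  obtain ⟨q, hq⟩ : ∃ q : Fin (k + 6), q.val = 2 := ⟨⟨2, by omega⟩, rfl⟩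
  obtain ⟨w, hw⟩ : ∃ w : Fin (k + 6), w.val = 3 := ⟨⟨3, by omega⟩, rfl⟩
  obtain ⟨f, hf⟩ : ∃ f : Fin (k + 6), f.val = 4 := ⟨⟨4, by omega⟩, rfl⟩
  have hc₁ := h₁.hubArcs_cuts (hU ▸ Finset.subset_union_left) hv hp hq hw hf
  have hc₂ := h₂.hubArcs_cuts (hU ▸ Finset.subset_union_right) hv hp hq hw hf
  have hd : ∀ a b, (a, b) ∈ A₁ → (a, b) ∉ A₂ := fun a b h => Finset.disjoint_left.1 hD h
  have hvw := hd v w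
  have hqf := hd q f
  have hqv := hd q v
  have hpv := hd p v
  have hpq := hd p q
  clear hd h₁ h₂ hU hD
  grind

/-- Corollary 4.9: for every `n` there is a 2-strong split digraph on more than `n`
vertices having no strong arc decomposition. -/
theorem stmt19 (n : ℕ) (hn : 0 < n) :
    ∃ (m : ℕ) (V₁ V₂ : Finset (Fin m)) (A : Finset (Fin m × Fin m)),
      n < m ∧ IsSplitDigraph V₁ V₂ A ∧ KStrong 2 A ∧ ¬ StrongArcDecomp A := by
  exact ⟨n + 6, {0}, {0}ᶜ, hubArcs (n + 6), by omega, isSplitDigraph_hubArcs n,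
    kStrong_two_hubArcs n, not_strongArcDecomp_hubArcs n⟩
end
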